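/- λ₃(H_0 ∩ H_1) = 2·q_1 − 1, and for every finite binary string σ of length n ≥ 1, λ₃(H_{σ0} ∩ H_{σ1}) = 2·q_{n+1} − q_n; equivalently, the conditional probability that F_x hits both [σ0] and [σ1] given that it hits [σ] equals 2·(q_{n+1}/q_n) − 1. -/

import Mathlib

open MeasureTheory
open scoped ENNReal

/-- Value of a binary string read as a binary numeral (most significant bit first). -/
def strVal (σ : List Bool) : ℕ := σ.foldl (fun n b => 2 * n + b.toNat) 0

/-- Index of a binary string in the length-lexicographic enumeration of `{0,1}^{<ω}`,
so that `strIdx (strAt n) = n`. -/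
def strIdx (σ : List Bool) : ℕ := 2 ^ σ.length + strVal σ - 1

/-- The `n`-th binary string `σ_n` in the length-lexicographic enumeration
(`strAt 0` is the empty string). -/
def strAt : ℕ → List Bool
  | 0 => []
  | n + 1 => strAt (n / 2) ++ [decide (n % 2 = 1)]
decreasing_by omega

/-- The initial segment `z↾n` of an infinite binary sequence, as a list. -/
def initSeg (z : ℕ → Bool) (n : ℕ) : List Bool := (List.range n).map z

/-- The basic cylinder `[σ]` of all infinite binary sequences extending `σ`. -/
def cyl (σ : List Bool) : Set (ℕ → Bool) := {z | initSeg z σ.length = σ}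

/-- The label in `{0,1,2}` assigned by `x ∈ {0,1,2}^ω` to a nonempty binary string:
`ℓ_x(σ_i) = x (i − 1)`, where `σ_i` is the `i`-th string in length-lexicographic order. -/
def labelOf (x : ℕ → Fin 3) (σ : List Bool) : Fin 3 := x (strIdx σ - 1)

/-- The label read along `y` at stage `n`, namely `ℓ_x(y↾(n+1))`. -/
def flabel (x : ℕ → Fin 3) (y : ℕ → Bool) (n : ℕ) : Fin 3 := labelOf x (initSeg y (n + 1))

/-- `y` belongs to the domain of `F_x`: infinitely many of the labels along `y` lie in
`{0,1}`. -/
def Fdom (x : ℕ → Fin 3) (y : ℕ → Bool) : Prop := {n | flabel x y n ≠ 2}.Infinite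

/-- The value `F_x(y)(k)`: the `k`-th label along `y` lying in `{0,1}` (obtained by deleting
all labels `2`), read as a bit.  (Junk value if `y ∉ dom F_x`.) -/
noncomputable def Fapp (x : ℕ → Fin 3) (y : ℕ → Bool) (k : ℕ) : Bool :=
  decide (flabel x y (Nat.nth (fun n => flabel x y n ≠ 2) k) = 1)

/-- `H_σ`: the set of codes `x ∈ {0,1,2}^ω` such that `F_x` hits the cylinder `[σ]`. -/
def Hset (σ : List Bool) : Set (ℕ → Fin 3) := {x | ∃ y, Fdom x y ∧ Fapp x y ∈ cyl σ}

/-- `q_n = λ₃(H_{0^n})`: the probability that `F_x` hits `[0^n]`. -/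
noncomputable def qseq (μ3 : Measure (ℕ → Fin 3)) (n : ℕ) : ℝ :=
  (μ3 (Hset (List.replicate n false))).toReal

/-! ### The length-lexicographic enumeration -/

theorem strIdx_append_singleton (σ : List Bool) (b : Bool) :
    strIdx (σ ++ [b]) = 2 * strIdx σ + b.toNat + 1 := by
  have h : 0 < 2 ^ σ.length := by positivity
  simp only [strIdx, strVal, List.length_append, List.length_singleton, List.foldl_append,
    List.foldl_cons, List.foldl_nil, pow_succ]
  omega

theorem strAt_strIdx (σ : List Bool) : strAt (strIdx σ) = σ := by
  induction σ using List.reverseRecOn with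
  | nil => simp [strIdx, strVal, strAt]
  | append_singleton σ b ih =>
    rw [strIdx_append_singleton, strAt]
    have h1 : (2 * strIdx σ + b.toNat) / 2 = strIdx σ := by cases b <;> simp; omega
    have h2 : decide ((2 * strIdx σ + b.toNat) % 2 = 1) = b := by cases b <;> simp
    rw [h1, h2, ih]

theorem strIdx_strAt (n : ℕ) : strIdx (strAt n) = n := by
  induction n using Nat.strong_induction_on with
  | _ n ih =>
    match n with
    | 0 => simp [strIdx, strVal, strAt]
    | m + 1 =>
      rw [strAt, strIdx_append_singleton, ih (m / 2) (by omega)]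
      rcases Nat.mod_two_eq_zero_or_one m with h | h <;> simp [h] <;> omega

theorem initSeg_succ (y : ℕ → Bool) (n : ℕ) : initSeg y (n + 1) = initSeg y n ++ [y n] := by
  simp [initSeg, List.range_succ]

theorem length_initSeg (y : ℕ → Bool) (n : ℕ) : (initSeg y n).length = n := by
  simp [initSeg]

theorem initSeg_congr {y z : ℕ → Bool} {n : ℕ} (h : ∀ k < n, y k = z k) :
    initSeg y n = initSeg z n := by
  simpa [initSeg] using h

theorem getD_initSeg (y : ℕ → Bool) {n k : ℕ} (hk : k < n) :
    (initSeg y n).getD k false = y k := by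
  simp [initSeg, List.getD_eq_getElem?_getD, hk]

theorem initSeg_getD (σ : List Bool) : initSeg (fun k => σ.getD k false) σ.length = σ := by
  refine List.ext_getElem (by simp [initSeg]) fun k h₁ h₂ => ?_
  simp [initSeg, h₂]

theorem mem_cyl_iff {σ : List Bool} {z : ℕ → Bool} :
    z ∈ cyl σ ↔ ∀ k < σ.length, z k = σ.getD k false := by
  constructor
  · intro h k hk
    have h' : initSeg z σ.length = σ := h
    rw [← getD_initSeg z hk, h']
  · exact fun h => (initSeg_congr h).trans (initSeg_getD σ)

/-- The coordinate of the code that labels `y↾(n+1)`. -/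
def nodeIdx (y : ℕ → Bool) (n : ℕ) : ℕ := strIdx (initSeg y (n + 1)) - 1

theorem flabel_eq (x : ℕ → Fin 3) (y : ℕ → Bool) (n : ℕ) : flabel x y n = x (nodeIdx y n) := rfl

theorem nodeIdx_add_one (y : ℕ → Bool) (n : ℕ) :
    nodeIdx y n + 1 = strIdx (initSeg y (n + 1)) := by
  rw [nodeIdx, initSeg_succ, strIdx_append_singleton]
  omega

theorem nodeIdx_strictMono (y : ℕ → Bool) : StrictMono (nodeIdx y) := by
  refine strictMono_nat_of_lt_succ fun n => ?_
  have h := nodeIdx_add_one y n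
  have h' := nodeIdx_add_one y (n + 1)
  rw [initSeg_succ, strIdx_append_singleton] at h'
  omega

theorem nodeIdx_congr {y z : ℕ → Bool} {n : ℕ} (h : ∀ k ≤ n, y k = z k) :
    nodeIdx y n = nodeIdx z n := by
  rw [nodeIdx, nodeIdx, initSeg_congr fun k hk => h k (Nat.lt_succ_iff.1 hk)]

/-- The path through the string labelled by coordinate `i`, continued by zeros. -/
def pathTo (i k : ℕ) : Bool := (strAt (i + 1)).getD k false

/-- The number of nonempty proper prefixes of the string labelled by coordinate `i`. -/
def depthOf (i : ℕ) : ℕ := (strAt (i + 1)).length - 1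

theorem nodeIdx_pathTo (i : ℕ) : nodeIdx (pathTo i) (depthOf i) = i := by
  have hlen : depthOf i + 1 = (strAt (i + 1)).length := by
    rw [depthOf, strAt]
    simp
  have h : initSeg (pathTo i) (depthOf i + 1) = strAt (i + 1) := by
    rw [hlen]
    exact initSeg_getD _
  rw [nodeIdx, h, strIdx_strAt, Nat.add_sub_cancel]

theorem depthOf_nodeIdx (y : ℕ → Bool) (n : ℕ) : depthOf (nodeIdx y n) = n := by
  rw [depthOf, nodeIdx_add_one, strAt_strIdx, length_initSeg, Nat.add_sub_cancel]

theorem pathTo_nodeIdx (y : ℕ → Bool) {n k : ℕ} (hk : k ≤ n) : pathTo (nodeIdx y n) k = y k := by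
  rw [pathTo, nodeIdx_add_one, strAt_strIdx, getD_initSeg y (Nat.lt_succ_of_le hk)]

/-! ### The output along a path -/

/-- The number of labels in `{0,1}` among the first `n` labels along `y`. -/
def outCount (x : ℕ → Fin 3) (y : ℕ → Bool) (n : ℕ) : ℕ :=
  Nat.count (fun m => flabel x y m ≠ 2) n

theorem count_congr_of_lt {p q : ℕ → Prop} [DecidablePred p] [DecidablePred q] {n : ℕ}
    (h : ∀ m < n, (p m ↔ q m)) : Nat.count p n = Nat.count q n :=
  le_antisymm (Nat.count_mono_left fun m hm => (h m hm).1)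
    (Nat.count_mono_left fun m hm => (h m hm).2)

theorem outCount_congr {x x' : ℕ → Fin 3} {y y' : ℕ → Bool} {n : ℕ}
    (h : ∀ m < n, flabel x y m = flabel x' y' m) : outCount x y n = outCount x' y' n :=
  count_congr_of_lt fun m hm => by rw [h m hm]

theorem Fapp_congr {x x' : ℕ → Fin 3} {y y' : ℕ → Bool} {n k : ℕ}
    (h : ∀ m < n, flabel x y m = flabel x' y' m) (hk : k < outCount x y n) :
    Fapp x y k = Fapp x' y' k := by
  have hlt : Nat.nth (fun m => flabel x y m ≠ 2) k < n := Nat.nth_lt_of_lt_count hk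
  have hcard : ∀ hf : {m | flabel x y m ≠ 2}.Finite, k < hf.toFinset.card := fun hf =>
    hk.trans_le (Nat.count_le_card hf n)
  have hmem := Nat.nth_mem k hcard
  have hcount := Nat.count_nth hcard
  unfold Fapp
  set i := Nat.nth (fun m => flabel x y m ≠ 2) k
  have hi : Nat.nth (fun m => flabel x' y' m ≠ 2) k = i := by
    have hc : Nat.count (fun m => flabel x' y' m ≠ 2) i = k := by
      rw [← hcount]
      exact (outCount_congr fun m hm => h m (hm.trans hlt)).symm
    rw [← hc]
    exact Nat.nth_count (p := fun m => flabel x' y' m ≠ 2) (by rw [← h i hlt]; exact hmem)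
  rw [hi, h i hlt]

/-- The codes for which some path produces at least `σ` after finitely many labels. -/
def finHset (σ : List Bool) : Set (ℕ → Fin 3) :=
  {x | ∃ y n, σ.length ≤ outCount x y n ∧ Fapp x y ∈ cyl σ}

theorem isOpen_finHset (σ : List Bool) : IsOpen (finHset σ) := by
  rw [(PiNat.isTopologicalBasis_cylinders (fun _ : ℕ => Fin 3)).isOpen_iff]
  rintro x ⟨y, n, hn, hx⟩
  refine ⟨_, ⟨x, nodeIdx y n, rfl⟩, PiNat.self_mem_cylinder _ _, fun x' hx' => ?_⟩
  have h : ∀ m < n, flabel x y m = flabel x' y m := fun m hm =>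
    (hx' _ (nodeIdx_strictMono y hm)).symm
  refine ⟨y, n, outCount_congr h ▸ hn, mem_cyl_iff.2 fun k hk => ?_⟩
  rw [← Fapp_congr h (hk.trans_le hn), mem_cyl_iff.1 hx k hk]

theorem Hset_subset_finHset (σ : List Bool) : Hset σ ⊆ finHset σ := by
  rintro x ⟨y, hdom, hy⟩
  exact ⟨y, Nat.nth (fun n => flabel x y n ≠ 2) σ.length,
    (Nat.count_nth_of_infinite hdom σ.length).ge, hy⟩

theorem mem_Hset_of_mem_finHset {σ : List Bool} {x : ℕ → Fin 3}
    (hgood : ∀ τ : List Bool, Fdom x fun k => τ.getD k false) (hx : x ∈ finHset σ) :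
    x ∈ Hset σ := by
  obtain ⟨y, n, hn, hy⟩ := hx
  refine ⟨_, hgood (initSeg y n), mem_cyl_iff.2 fun k hk => ?_⟩
  rw [← mem_cyl_iff.1 hy k hk]
  refine (Fapp_congr (fun m hm => ?_) (hk.trans_le hn)).symm
  rw [flabel_eq, flabel_eq, nodeIdx_congr fun k hk => (getD_initSeg y (hk.trans_lt hm)).symm]

theorem Hset_append_union (σ : List Bool) :
    Hset (σ ++ [false]) ∪ Hset (σ ++ [true]) = Hset σ := by
  have h : ∀ b z, z ∈ cyl (σ ++ [b]) ↔ z ∈ cyl σ ∧ z σ.length = b := fun b z => by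
    simp only [cyl, Set.mem_ofPred_eq, List.length_append, List.length_singleton, initSeg_succ]
    exact ⟨fun h => by simpa using List.append_inj h (length_initSeg z σ.length),
      fun ⟨h₁, h₂⟩ => by rw [h₁, h₂]⟩
  ext x
  simp only [Hset, Set.mem_union, Set.mem_ofPred_eq, h]
  constructor
  · rintro (⟨y, hd, hy, -⟩ | ⟨y, hd, hy, -⟩) <;> exact ⟨y, hd, hy⟩
  · rintro ⟨y, hd, hy⟩
    cases hb : Fapp x y σ.length
    · exact Or.inl ⟨y, hd, hy, hb⟩
    · exact Or.inr ⟨y, hd, hy, hb⟩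

/-! ### Flipping the output -/

/-- Exchange the labels `0` and `1` if `b` is true. -/
def flipLabel (b : Bool) (a : Fin 3) : Fin 3 := if b then Equiv.swap 0 1 a else a

theorem flipLabel_eq_two : ∀ (b : Bool) (a : Fin 3), flipLabel b a = 2 ↔ a = 2 := by decide

theorem flipLabel_flipLabel : ∀ (b : Bool) (a : Fin 3), flipLabel b (flipLabel b a) = a := by
  decide

theorem decide_flipLabel_eq_one : ∀ (b : Bool) (a : Fin 3), a ≠ 2 →
    decide (flipLabel b a = 1) = xor (decide (a = 1)) b := by decide

/-- Recode `x` so that the `k`-th output bit is flipped along every path whenever `s k` holds. -/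
def flipCode (s : ℕ → Bool) (x : ℕ → Fin 3) (i : ℕ) : Fin 3 :=
  flipLabel (s (outCount x (pathTo i) (depthOf i))) (x i)

theorem flabel_flipCode (s : ℕ → Bool) (x : ℕ → Fin 3) (y : ℕ → Bool) (n : ℕ) :
    flabel (flipCode s x) y n = flipLabel (s (outCount x y n)) (flabel x y n) := by
  have h : outCount x (pathTo (nodeIdx y n)) n = outCount x y n :=
    outCount_congr fun m hm => by
      rw [flabel_eq, flabel_eq,
        nodeIdx_congr fun k hk => pathTo_nodeIdx y (hk.trans hm.le)]
  rw [flabel_eq, flipCode, depthOf_nodeIdx, h, flabel_eq]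

theorem flabel_flipCode_ne_two (s : ℕ → Bool) (x : ℕ → Fin 3) (y : ℕ → Bool) :
    (fun n => flabel (flipCode s x) y n ≠ 2) = fun n => flabel x y n ≠ 2 := by
  funext n
  rw [flabel_flipCode, ne_eq, flipLabel_eq_two]

theorem outCount_flipCode (s : ℕ → Bool) (x : ℕ → Fin 3) (y : ℕ → Bool) (n : ℕ) :
    outCount (flipCode s x) y n = outCount x y n :=
  count_congr_of_lt fun m _ => iff_of_eq (congrFun (flabel_flipCode_ne_two s x y) m)

theorem Fdom_flipCode (s : ℕ → Bool) (x : ℕ → Fin 3) (y : ℕ → Bool) :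
    Fdom (flipCode s x) y ↔ Fdom x y := by
  rw [Fdom, flabel_flipCode_ne_two, Fdom]

theorem Fapp_flipCode (s : ℕ → Bool) {x : ℕ → Fin 3} {y : ℕ → Bool} (hy : Fdom x y) (k : ℕ) :
    Fapp (flipCode s x) y k = xor (Fapp x y k) (s k) := by
  have hk : outCount x y (Nat.nth (fun n => flabel x y n ≠ 2) k) = k :=
    Nat.count_nth_of_infinite hy k
  rw [Fapp, flabel_flipCode_ne_two, flabel_flipCode, hk,
    decide_flipLabel_eq_one _ _ (Nat.nth_mem_of_infinite hy k), Fapp]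

theorem flipCode_preimage_Hset (σ : List Bool) :
    flipCode (fun k => σ.getD k false) ⁻¹' Hset (List.replicate σ.length false) = Hset σ := by
  ext x
  simp only [Hset, Set.mem_preimage, Set.mem_ofPred_eq, Fdom_flipCode]
  refine exists_congr fun y => and_congr_right fun hy => ?_
  rw [mem_cyl_iff, mem_cyl_iff, List.length_replicate]
  refine forall₂_congr fun k hk => ?_
  rw [Fapp_flipCode _ hy]
  simp [hk]

theorem flipCode_flipCode (s : ℕ → Bool) (x : ℕ → Fin 3) : flipCode s (flipCode s x) = x := by
  funext i
  rw [flipCode, outCount_flipCode, flipCode, flipLabel_flipLabel]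

theorem flipCode_congr (s : ℕ → Bool) {x x' : ℕ → Fin 3} {n : ℕ} (h : ∀ i < n, x i = x' i) :
    ∀ i < n, flipCode s x i = flipCode s x' i := by
  intro i hi
  rw [flipCode, flipCode, h i hi, outCount_congr (x' := x') (y' := pathTo i) fun m hm => ?_]
  refine h _ (lt_trans ?_ hi)
  exact (nodeIdx_strictMono _ hm).trans_eq (nodeIdx_pathTo i)

theorem flipCode_preimage_cylinder (s : ℕ → Bool) (w : ℕ → Fin 3) (n : ℕ) :
    flipCode s ⁻¹' {x | ∀ i < n, x i = w i} = {x | ∀ i < n, x i = flipCode s w i} := by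
  ext x
  constructor
  · intro h i hi
    have := flipCode_congr s h i hi
    rwa [flipCode_flipCode] at this
  · intro h i hi
    have := flipCode_congr s h i hi
    rwa [flipCode_flipCode] at this

theorem continuous_flipCode (s : ℕ → Bool) : Continuous (flipCode s) := by
  rw [(PiNat.isTopologicalBasis_cylinders (fun _ : ℕ => Fin 3)).continuous_iff]
  rintro _ ⟨w, n, rfl⟩
  exact flipCode_preimage_cylinder s w n ▸ PiNat.isOpen_cylinder _ (flipCode s w) n

/-! ### The uniform measure -/

theorem measure_ext_of_cylinder {μ ν : Measure (ℕ → Fin 3)} [IsProbabilityMeasure μ]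
    [IsProbabilityMeasure ν]
    (h : ∀ (n : ℕ) (w : ℕ → Fin 3), μ {x | ∀ i < n, x i = w i} = ν {x | ∀ i < n, x i = w i}) :
    μ = ν := by
  refine ext_of_generate_finite _ (BorelSpace.measurable_eq.trans
    (PiNat.isTopologicalBasis_cylinders (fun _ : ℕ => Fin 3)).borel_eq_generateFrom) ?_ ?_
    (by simp)
  · rintro _ ⟨v, m, rfl⟩ _ ⟨w, n, rfl⟩ ⟨z, hz, hz'⟩
    refine ⟨z, max m n, ?_⟩
    ext x
    simp only [Set.mem_inter_iff, PiNat.mem_cylinder_iff] at *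
    constructor
    · rintro ⟨h₁, h₂⟩ i hi
      rcases lt_max_iff.1 hi with hi | hi
      · rw [h₁ i hi, hz i hi]
      · rw [h₂ i hi, hz' i hi]
    · exact fun h => ⟨fun i hi => (h i (lt_max_of_lt_left hi)).trans (hz i hi),
        fun i hi => (h i (lt_max_of_lt_right hi)).trans (hz' i hi)⟩
  · rintro _ ⟨w, n, rfl⟩
    exact h n w

section Uniform

variable {μ : Measure (ℕ → Fin 3)} [IsProbabilityMeasure μ]

theorem measurePreserving_flipCode
    (hμ : ∀ (n : ℕ) (w : ℕ → Fin 3), μ {x | ∀ i < n, x i = w i} = (1 / 3 : ℝ≥0∞) ^ n)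
    (s : ℕ → Bool) : MeasurePreserving (flipCode s) μ μ := by
  have hm := (continuous_flipCode s).measurable
  have := Measure.isProbabilityMeasure_map (μ := μ) hm.aemeasurable
  refine ⟨hm, measure_ext_of_cylinder fun n w => ?_⟩
  have hw : MeasurableSet {x : ℕ → Fin 3 | ∀ i < n, x i = w i} :=
    (PiNat.isOpen_cylinder _ w n).measurableSet
  rw [Measure.map_apply hm hw, flipCode_preimage_cylinder, hμ, hμ]

theorem measure_forall_mem_eq
    (hμ : ∀ (n : ℕ) (w : ℕ → Fin 3), μ {x | ∀ i < n, x i = w i} = (1 / 3 : ℝ≥0∞) ^ n)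
    (s : Finset ℕ) (w : ℕ → Fin 3) : μ {x | ∀ i ∈ s, x i = w i} = (1 / 3 : ℝ≥0∞) ^ s.card := by
  let ν : Measure (ℕ → Fin 3) :=
    Measure.infinitePi fun _ => (PMF.uniformOfFintype (Fin 3)).toMeasure
  have hν : ∀ (s : Finset ℕ) (w : ℕ → Fin 3),
      ν {x | ∀ i ∈ s, x i = w i} = (1 / 3 : ℝ≥0∞) ^ s.card := fun s w => by
    have h : {x : ℕ → Fin 3 | ∀ i ∈ s, x i = w i} = Set.pi s fun i => {w i} := by
      ext x
      simp
    refine h ▸ (Measure.infinitePi_pi _ fun _ _ => measurableSet_singleton _).trans ?_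
    simp
  have : μ = ν := measure_ext_of_cylinder fun n w => by
    rw [hμ]
    simpa using (hν (Finset.range n) w).symm
  rw [this, hν]

theorem ae_Fdom
    (hμ : ∀ (n : ℕ) (w : ℕ → Fin 3), μ {x | ∀ i < n, x i = w i} = (1 / 3 : ℝ≥0∞) ^ n)
    (y : ℕ → Bool) : ∀ᵐ x ∂μ, Fdom x y := by
  have key : ∀ N : ℕ, ∀ᵐ x ∂μ, ∃ n ≥ N, flabel x y n ≠ 2 := fun N => by
    rw [ae_iff]
    refine le_antisymm (ge_of_tendsto' (ENNReal.tendsto_pow_atTop_nhds_zero_of_lt_one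
      (r := 1 / 3) (by simp)) fun K => ?_) zero_le
    let s : Finset ℕ := (Finset.Ico N (N + K)).image (nodeIdx y)
    have hs : s.card = K := by
      rw [Finset.card_image_of_injective _ (nodeIdx_strictMono y).injective]
      simp
    rw [← hs, ← measure_forall_mem_eq hμ s fun _ => 2]
    refine measure_mono fun x hx i hi => ?_
    obtain ⟨n, hn, rfl⟩ := Finset.mem_image.1 hi
    simp only [not_exists, not_and, not_not, Set.mem_ofPred_eq] at hx
    exact hx n (Finset.mem_Ico.1 hn).1
  filter_upwards [ae_all_iff.2 key] with x hx
  refine Set.infinite_of_forall_exists_gt fun N => ?_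
  obtain ⟨n, hn, h⟩ := hx (N + 1)
  exact ⟨n, h, hn⟩

theorem nullMeasurableSet_Hset
    (hμ : ∀ (n : ℕ) (w : ℕ → Fin 3), μ {x | ∀ i < n, x i = w i} = (1 / 3 : ℝ≥0∞) ^ n)
    (σ : List Bool) : NullMeasurableSet (Hset σ) μ := by
  refine (isOpen_finHset σ).measurableSet.nullMeasurableSet.congr ?_
  filter_upwards [ae_all_iff.2 fun τ : List Bool => ae_Fdom hμ fun k => τ.getD k false] with x hx
  exact propext ⟨mem_Hset_of_mem_finHset hx, fun h => Hset_subset_finHset σ h⟩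

theorem toReal_measure_Hset
    (hμ : ∀ (n : ℕ) (w : ℕ → Fin 3), μ {x | ∀ i < n, x i = w i} = (1 / 3 : ℝ≥0∞) ^ n)
    (σ : List Bool) : (μ (Hset σ)).toReal = qseq μ σ.length := by
  rw [← flipCode_preimage_Hset σ, (measurePreserving_flipCode hμ _).measure_preimage
    (nullMeasurableSet_Hset hμ _), qseq]

theorem qseq_zero
    (hμ : ∀ (n : ℕ) (w : ℕ → Fin 3), μ {x | ∀ i < n, x i = w i} = (1 / 3 : ℝ≥0∞) ^ n) :
    qseq μ 0 = 1 := by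
  have h : ∀ᵐ x ∂μ, x ∈ Hset [] := by
    filter_upwards [ae_Fdom hμ fun _ => false] with x hx
    exact ⟨_, hx, rfl⟩
  have h' : Hset [] =ᵐ[μ] Set.univ := Filter.eventuallyEq_univ.2 h
  simp [qseq, measure_congr h']

theorem toReal_measure_Hset_inter
    (hμ : ∀ (n : ℕ) (w : ℕ → Fin 3), μ {x | ∀ i < n, x i = w i} = (1 / 3 : ℝ≥0∞) ^ n)
    (σ : List Bool) : (μ (Hset (σ ++ [false]) ∩ Hset (σ ++ [true]))).toReal =
      2 * qseq μ (σ.length + 1) - qseq μ σ.length := by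
  have h := measure_union_add_inter₀ (μ := μ) (Hset (σ ++ [false]))
    (nullMeasurableSet_Hset hμ (σ ++ [true]))
  rw [Hset_append_union] at h
  have h' := congrArg ENNReal.toReal h
  rw [ENNReal.toReal_add (measure_ne_top _ _) (measure_ne_top _ _),
    ENNReal.toReal_add (measure_ne_top _ _) (measure_ne_top _ _), toReal_measure_Hset hμ,
    toReal_measure_Hset hμ, toReal_measure_Hset hμ, List.length_append, List.length_append] at h'
  simp only [List.length_singleton] at h'
  linarith

end Uniform

/-- Let `λ₃` be the uniform product measure on `{0,1,2}^ω`, characterized by its values on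
cylinders, and `q_n = λ₃(H_{0^n})`.  Then `λ₃(H_0 ∩ H_1) = 2·q_1 − 1`, and for every binary
string `σ` of length `n ≥ 1`, `λ₃(H_{σ0} ∩ H_{σ1}) = 2·q_{n+1} − q_n`. -/
theorem hitting_both_children
    (μ3 : Measure (ℕ → Fin 3)) [IsProbabilityMeasure μ3]
    (h3 : ∀ (n : ℕ) (w : ℕ → Fin 3), μ3 {x | ∀ i < n, x i = w i} = (1 / 3 : ℝ≥0∞) ^ n) :
    (μ3 (Hset [false] ∩ Hset [true])).toReal = 2 * qseq μ3 1 - 1 ∧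
      ∀ n : ℕ, 1 ≤ n → ∀ σ : List Bool, σ.length = n →
        (μ3 (Hset (σ ++ [false]) ∩ Hset (σ ++ [true]))).toReal =
          2 * qseq μ3 (n + 1) - qseq μ3 n := by
  refine ⟨?_, fun n _ σ hσ => hσ ▸ toReal_measure_Hset_inter h3 σ⟩
  have h := toReal_measure_Hset_inter h3 []
  rwa [List.length_nil, qseq_zero h3] at h
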